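/- Let f be a polynomial in three real variables of total degree 3, and suppose that the complexification of f (the polynomial with the same coefficients viewed over ℂ) has only finitely many critical points in ℂ³, i.e., the set of points of ℂ³ where all three complex partial derivatives of f vanish is finite. Then there do not exist four pairwise distinct points of ℝ³, all lying in a common affine plane of ℝ³, such that each of the four points is a nondegenerate critical point of f and the Morse indices of f at these four points all have the same parity. -/

import Mathlib

open MvPolynomial Matrix

/-- The Hessian matrix of a polynomial in three real variables at a point. -/
noncomputable def hess3 (f : MvPolynomial (Fin 3) ℝ) (p : Fin 3 → ℝ) :
    Matrix (Fin 3) (Fin 3) ℝ :=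
  Matrix.of fun i j => eval p (pderiv i (pderiv j f))

/-- A point of ℝ³ is a critical point of a polynomial in three variables if all three
partial derivatives vanish there. -/
def IsCriticalPt3 (f : MvPolynomial (Fin 3) ℝ) (p : Fin 3 → ℝ) : Prop :=
  ∀ i, eval p (pderiv i f) = 0

/-- The Morse index at a point: the number of negative eigenvalues (with multiplicity)
of the Hessian matrix there (junk value 0 if the Hessian is not symmetric). -/
noncomputable def morseIndex3 (f : MvPolynomial (Fin 3) ℝ) (p : Fin 3 → ℝ) : ℕ :=
  if h : (hess3 f p).IsHermitian then {i : Fin 3 | h.eigenvalues i < 0}.ncard else 0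

/-- The part of the determinant identity not involving the lower right entries. -/
lemma core_quad (a b d x y z s t m n : ℝ) (hm : m*t = s-1) (hn : n*s=t-1)
    (h1 : m*a+2*b+n*b=0) (h2 : m*b+2*b+n*d=0) (h3 : 2*y = -(m*x+n*z)) :
    (1-s-t)^2 * (a*z^2-2*b*x*z+d*x^2) + s^2*(-a*(2*y-z)^2 + 2*b*(2*y-z)*x - (2*b-d)*x^2)
    + t^2*(-(2*b-a)*z^2 + 2*b*z*(2*y-x)-d*(2*y-x)^2) +
    (-(-a+2*s*a+2*t*b)*(-z+2*s*y+2*t*z)^2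
     + 2*(-b+2*s*b+2*t*b)*(-z+2*s*y+2*t*z)*(-x+2*s*x+2*t*y)
     - (-x+2*s*x+2*t*y)^2 * (-d+2*s*b+2*t*d)) = 0 := by
  grind (ringSteps := 1000000)

lemma core_J3 (a b d s t : ℝ) (hs : s ≠ 0) (ht : t ≠ 0)
    (h1 : s*(s-1)*a+2*s*t*b+t*(t-1)*b=0) (h2 : s*(s-1)*b+2*s*t*b+t*(t-1)*d=0) :
    s*(a*(2*b-d)-b^2) + ((-a+2*s*a+2*t*b)*(-d+2*s*b+2*t*d)-(-b+2*s*b+2*t*b)^2)=0 := by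
  grind

lemma core_J2 (a b d s t : ℝ) (hs : s ≠ 0) (ht : t ≠ 0)
    (h1 : s*(s-1)*a+2*s*t*b+t*(t-1)*b=0) (h2 : s*(s-1)*b+2*s*t*b+t*(t-1)*d=0) :
    t*(d*(2*b-a)-b^2) + ((-a+2*s*a+2*t*b)*(-d+2*s*b+2*t*d)-(-b+2*s*b+2*t*b)^2)=0 := by
  grind

lemma core_J0 (a b d s t : ℝ) (hs : s ≠ 0) (ht : t ≠ 0)
    (h1 : s*(s-1)*a+2*s*t*b+t*(t-1)*b=0) (h2 : s*(s-1)*b+2*s*t*b+t*(t-1)*d=0) :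
    (1-s-t)*(a*d-b^2) - s*(a*(2*b-d)-b^2)=0 := by
  grind

lemma core_det (a b d x y z r be ga s t : ℝ) (hs : s ≠ 0) (ht : t ≠ 0)
    (h1 : s*(s-1)*a+2*s*t*b+t*(t-1)*b=0) (h2 : s*(s-1)*b+2*s*t*b+t*(t-1)*d=0)
    (h3 : s*(s-1)*x+2*s*t*y+t*(t-1)*z=0) (A U W : Matrix (Fin 3) (Fin 3) ℝ)
    (hA : A = !![-a/2,-b/2,-x/2;-b/2,-d/2,-z/2;-x/2,-z/2,r])
    (hU : U = !![a,b,x;b,b,y;x,y,be])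
    (hW : W = !![b,b,y;b,d,z;y,z,ga]) :
    (1-s-t)^2 * A.det + s^2*(A+U).det + t^2 * (A+W).det + (A + s•U + t•W).det = 0 := by
  have e3 := core_J3 a b d s t hs ht h1 h2
  have e2 := core_J2 a b d s t hs ht h1 h2
  have e0 := core_J0 a b d s t hs ht h1 h2
  have hst : s*t ≠ 0 := mul_ne_zero hs ht
  have q := core_quad a b d x y z s t ((s-1)/t) ((t-1)/s) (by field_simp) (by field_simp)
    (by field_simp; linear_combination h1)
    (by field_simp; linear_combination h2)
    (by field_simp; linear_combination h3)
  subst hU hW hA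
  simp only [Matrix.det_fin_three]
  simp
  linear_combination (1/8)*q + (1/4)*(r*((1-s-t)*e0 + (1-s-t)*e3 + s*e3+t*e2) +be*s*e3+ga*t*e2)

lemma core_std (A U W : Matrix (Fin 3) (Fin 3) ℝ) (s t : ℝ) (hs : s ≠ 0) (ht : t ≠ 0)
    (hA : Aᵀ = A) (hU : Uᵀ = U) (hW : Wᵀ = W)
    (h1 : ∀ i, U i 1 = W i 0) (h2 : ∀ i, 2 * A i 0 = - U i 0) (h3 : ∀ i, 2 * A i 1 = - W i 1)
    (h4 : ∀ i, s * (2 * A i 0 + s * U i 0 + t * W i 0)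
      + t * (2 * A i 1 + s * U i 1 + t * W i 1) = 0) :
    (1-s-t)^2 * A.det + s^2*(A+U).det + t^2 * (A+W).det + (A + s•U + t•W).det = 0 := by
  have sA : ∀ i j, A i j = A j i := fun i j => congrFun (congrFun hA j) i
  have sU : ∀ i j, U i j = U j i := fun i j => congrFun (congrFun hU j) i
  have sW : ∀ i j, W i j = W j i := fun i j => congrFun (congrFun hW j) i
  have a01 := sA 0 1
  have a02 := sA 0 2
  have a12 := sA 1 2
  have u01 := sU 0 1
  have u02 := sU 0 2
  have u12 := sU 1 2
  have w01 := sW 0 1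
  have w02 := sW 0 2
  have w12 := sW 1 2
  have p0 := h1 0
  have p1 := h1 1
  have p2 := h1 2
  have q0 := h2 0
  have q1 := h2 1
  have q2 := h2 2
  have r0 := h3 0
  have r1 := h3 1
  have r2 := h3 2
  have k0 := h4 0
  have k1 := h4 1
  have k2 := h4 2
  apply core_det (U 0 0) (U 0 1) (W 1 1) (U 0 2) (U 1 2) (W 1 2) (A 2 2) (U 2 2) (W 2 2) s t hs ht
  · have : W 0 1 = U 0 1 := by linarith
    linear_combination k0 - s*q0 - t*r0 +s*t*p0 - (t^2 - t)*this
  · have e : W 0 1 = U 0 1 := by linarith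
    have e' : U 1 1 = U 0 1 := by linarith
    have e2 : W 1 0 = U 0 1 := by linarith
    linear_combination k1 - s*q1 - t*r1 - s*t*e2 - s*t*e'+ (s^2-s)*u01
  · linear_combination k2 - s*q2 - t*r2 + s*t*p2 + 2*s*t*u12 + (s^2-s)*u02 + (t^2-t)*w12
  all_goals
    ext i j
    fin_cases i <;> fin_cases j <;> simp <;> linarith

lemma core_gen (A U W : Matrix (Fin 3) (Fin 3) ℝ) (s t : ℝ) (hs : s ≠ 0) (ht : t ≠ 0)
    (hA : Aᵀ = A) (hU : Uᵀ = U) (hW : Wᵀ = W) (u w : Fin 3 → ℝ)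
    (huw : LinearIndependent ℝ ![u, w])
    (h1 : U *ᵥ w = W *ᵥ u) (h2 : (2:ℝ) • A *ᵥ u = - U *ᵥ u) (h3 : (2:ℝ) • A *ᵥ w = - W *ᵥ w)
    (h4 : ((2:ℝ) • A + s • U + t • W) *ᵥ (s • u + t • w) = 0) :
    (1-s-t)^2 * A.det + s^2*(A+U).det + t^2 * (A+W).det + (A + s•U + t•W).det = 0 := by
  set m := crossProduct u w with hm
  have hm0 : m ≠ 0 := crossProduct_ne_zero_iff_linearIndependent.mpr huw
  set G : Matrix (Fin 3) (Fin 3) ℝ := (Matrix.of ![u, w, m])ᵀ with hG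
  have hdet : G.det ≠ 0 := by
    have : G.det = m ⬝ᵥ m := by
      rw [hG, Matrix.det_transpose, hm]
      simp [Matrix.det_fin_three, crossProduct, dotProduct, Fin.sum_univ_three]
      ring
    rw [this]
    simpa [dotProduct_self_eq_zero] using hm0
  have g0 : ∀ M : Matrix (Fin 3) (Fin 3) ℝ, ∀ i, (Gᵀ * M * G) i 0 = (Gᵀ *ᵥ (M *ᵥ u)) i := by
    intro M i
    rw [Matrix.mulVec_mulVec]; rfl
  have g1 : ∀ M : Matrix (Fin 3) (Fin 3) ℝ, ∀ i, (Gᵀ * M * G) i 1 = (Gᵀ *ᵥ (M *ᵥ w)) i := by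
    intro M i
    rw [Matrix.mulVec_mulVec]; rfl
  have key := core_std (Gᵀ * A * G) (Gᵀ * U * G) (Gᵀ * W * G) s t hs ht
    (by simp [Matrix.transpose_mul, hA, Matrix.mul_assoc])
    (by simp [Matrix.transpose_mul, hU, Matrix.mul_assoc])
    (by simp [Matrix.transpose_mul, hW, Matrix.mul_assoc])
    (by intro i; rw [g0, g1, h1])
    (by
      intro i
      have := congrFun (congrArg (fun v => Gᵀ *ᵥ v) h2) i
      rw [g0, g0]
      simpa [Matrix.mulVec_smul, Matrix.smul_mulVec, Matrix.mulVec_neg, Matrix.neg_mulVec] using this)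
    (by
      intro i
      have := congrFun (congrArg (fun v => Gᵀ *ᵥ v) h3) i
      rw [g1, g1]
      simpa [Matrix.mulVec_smul, Matrix.smul_mulVec, Matrix.mulVec_neg, Matrix.neg_mulVec] using this)
    (by
      intro i
      have := congrFun (congrArg (fun v => Gᵀ *ᵥ v) h4) i
      simp only [g0, g1]
      simp only [Matrix.mulVec_smul, Matrix.smul_mulVec, Matrix.mulVec_add, Matrix.add_mulVec,
        Pi.add_apply, Pi.smul_apply, smul_eq_mul, Matrix.mulVec_zero, Pi.zero_apply] at this
      linear_combination this)
  have e1 : Gᵀ * A * G + Gᵀ * U * G = Gᵀ * (A + U) * G := by noncomm_ring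
  have e2 : Gᵀ * A * G + Gᵀ * W * G = Gᵀ * (A + W) * G := by noncomm_ring
  have e3 : Gᵀ * A * G + s • (Gᵀ * U * G) + t • (Gᵀ * W * G) = Gᵀ * (A + s • U + t • W) * G := by
    simp [Matrix.mul_add, Matrix.add_mul]
  rw [e1, e2, e3] at key
  simp only [Matrix.det_mul, Matrix.det_transpose] at key
  have : G.det ^ 2 * ((1-s-t)^2 * A.det + s^2*(A+U).det + t^2 * (A+W).det
      + (A + s•U + t•W).det) = 0 := by linear_combination key
  exact (mul_eq_zero.mp this).resolve_left (pow_ne_zero _ hdet)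

/-- Induction principle for polynomials of degree at most three. -/
lemma deg3_induction (P : MvPolynomial (Fin 3) ℝ → Prop) (h0 : P 0)
    (hadd : ∀ f g, P f → P g → P (f + g))
    (hmon : ∀ (c : ℝ) (i j k : ℕ), i + j + k ≤ 3 → P (C c * (X 0 ^ i * X 1 ^ j * X 2 ^ k)))
    (f : MvPolynomial (Fin 3) ℝ) (hf : f.totalDegree ≤ 3) : P f := by
  rw [f.as_sum]
  have : ∀ S ⊆ f.support, P (∑ v ∈ S, monomial v (coeff v f)) := by
    intro S
    induction S using Finset.induction_on with
    | empty => intro _; simpa using h0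
    | insert v S hv ih =>
      intro hS
      rw [Finset.sum_insert hv]
      apply hadd
      · have h1 := le_totalDegree (hS (Finset.mem_insert_self v S))
        rw [Finsupp.sum_fintype _ _ (by simp), Fin.sum_univ_three] at h1
        rw [monomial_eq, Finsupp.prod_fintype _ _ (by simp), Fin.prod_univ_three]
        exact hmon _ _ _ _ (h1.trans hf)
      · exact ih (fun x hx => hS (Finset.mem_insert_of_mem hx))
  exact this _ subset_rfl

lemma pderiv_two (i : Fin 3) : pderiv i (2 : MvPolynomial (Fin 3) ℝ) = 0 := by
  exact_mod_cast (pderiv (R := ℝ) i).map_natCast 2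

lemma pderiv_three (i : Fin 3) : pderiv i (3 : MvPolynomial (Fin 3) ℝ) = 0 := by
  exact_mod_cast (pderiv (R := ℝ) i).map_natCast 3

set_option linter.all false in
set_option maxHeartbeats 4000000 in
lemma hess_symm (f : MvPolynomial (Fin 3) ℝ) (hf : f.totalDegree ≤ 3) (p : Fin 3 → ℝ) :
    (hess3 f p)ᵀ = hess3 f p := by
  ext i j
  simp only [hess3, Matrix.transpose_apply, Matrix.of_apply]
  refine deg3_induction (fun f => eval p (pderiv j (pderiv i f)) = eval p (pderiv i (pderiv j f)))
    (by simp) (fun f g hf hg => by simp [hf, hg]) ?_ f hf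
  intro c a b d habd
  have ha : a ≤ 3 := by omega
  have hb : b ≤ 3 := by omega
  have hd : d ≤ 3 := by omega
  fin_cases i <;> fin_cases j <;>
    simp [-mul_eq_mul_left_iff, -mul_eq_mul_right_iff, -mul_eq_zero, pderiv_mul, pderiv_pow,
      pderiv_X, Pi.single_apply, pderiv_two, pderiv_three] <;> ring

set_option linter.all false in
set_option maxHeartbeats 4000000 in
lemma hess_affine (f : MvPolynomial (Fin 3) ℝ) (hf : f.totalDegree ≤ 3) (p u w : Fin 3 → ℝ)
    (s t : ℝ) :
    hess3 f (p + (s • u + t • w)) = hess3 f p + s • (hess3 f (p + u) - hess3 f p)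
      + t • (hess3 f (p + w) - hess3 f p) := by
  ext i j
  simp only [hess3, Matrix.add_apply, Matrix.smul_apply, Matrix.sub_apply, Matrix.of_apply,
    smul_eq_mul]
  refine deg3_induction (fun f => eval (p + (s • u + t • w)) (pderiv i (pderiv j f)) =
    eval p (pderiv i (pderiv j f)) + s * (eval (p + u) (pderiv i (pderiv j f))
      - eval p (pderiv i (pderiv j f))) + t * (eval (p + w) (pderiv i (pderiv j f))
      - eval p (pderiv i (pderiv j f))))
    (by simp) (fun f g hf hg => by simp only [map_add, hf, hg]; ring) ?_ f hf
  intro c a b d habd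
  have ha : a ≤ 3 := by omega
  have hb : b ≤ 3 := by omega
  interval_cases a <;> interval_cases b <;> (have hd : d ≤ 3 := by omega) <;>
    interval_cases d <;> (try omega) <;> fin_cases i <;> fin_cases j <;>
    simp [-mul_eq_mul_left_iff, -mul_eq_mul_right_iff, -mul_eq_zero, pderiv_mul, pderiv_pow,
      pderiv_X, Pi.single_apply, pderiv_two, pderiv_three] <;> ring

set_option linter.all false in
set_option maxHeartbeats 4000000 in
lemma hess_third (f : MvPolynomial (Fin 3) ℝ) (hf : f.totalDegree ≤ 3) (p u w : Fin 3 → ℝ) :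
    (hess3 f (p + u) - hess3 f p) *ᵥ w = (hess3 f (p + w) - hess3 f p) *ᵥ u := by
  ext i
  simp only [hess3, Matrix.mulVec, dotProduct, Matrix.sub_apply, Matrix.of_apply,
    Fin.sum_univ_three]
  refine deg3_induction (fun f =>
    (eval (p + u) (pderiv i (pderiv 0 f)) - eval p (pderiv i (pderiv 0 f))) * w 0
    + (eval (p + u) (pderiv i (pderiv 1 f)) - eval p (pderiv i (pderiv 1 f))) * w 1
    + (eval (p + u) (pderiv i (pderiv 2 f)) - eval p (pderiv i (pderiv 2 f))) * w 2
    = (eval (p + w) (pderiv i (pderiv 0 f)) - eval p (pderiv i (pderiv 0 f))) * u 0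
    + (eval (p + w) (pderiv i (pderiv 1 f)) - eval p (pderiv i (pderiv 1 f))) * u 1
    + (eval (p + w) (pderiv i (pderiv 2 f)) - eval p (pderiv i (pderiv 2 f))) * u 2)
    (by simp) (fun f g hf hg => by
      simp only [map_add]; linear_combination hf + hg) ?_ f hf
  intro c a b d habd
  have ha : a ≤ 3 := by omega
  have hb : b ≤ 3 := by omega
  interval_cases a <;> interval_cases b <;> (have hd : d ≤ 3 := by omega) <;>
    interval_cases d <;> (try omega) <;> fin_cases i <;>
    simp [-mul_eq_mul_left_iff, -mul_eq_mul_right_iff, -mul_eq_zero, pderiv_mul, pderiv_pow,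
      pderiv_X, Pi.single_apply, pderiv_two, pderiv_three] <;> ring

set_option linter.all false in
set_option maxHeartbeats 4000000 in
lemma hess_mid (f : MvPolynomial (Fin 3) ℝ) (hf : f.totalDegree ≤ 3) (p u : Fin 3 → ℝ)
    (hp : IsCriticalPt3 f p) (hq : IsCriticalPt3 f (p + u)) :
    (hess3 f p + hess3 f (p + u)) *ᵥ u = 0 := by
  ext i
  have h1 := hp i
  have h2 := hq i
  have key : (eval p (pderiv i (pderiv 0 f)) + eval (p + u) (pderiv i (pderiv 0 f))) * u 0
    + (eval p (pderiv i (pderiv 1 f)) + eval (p + u) (pderiv i (pderiv 1 f))) * u 1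
    + (eval p (pderiv i (pderiv 2 f)) + eval (p + u) (pderiv i (pderiv 2 f))) * u 2
    = 2 * (eval (p + u) (pderiv i f) - eval p (pderiv i f)) := by
    refine deg3_induction (fun f =>
      (eval p (pderiv i (pderiv 0 f)) + eval (p + u) (pderiv i (pderiv 0 f))) * u 0
      + (eval p (pderiv i (pderiv 1 f)) + eval (p + u) (pderiv i (pderiv 1 f))) * u 1
      + (eval p (pderiv i (pderiv 2 f)) + eval (p + u) (pderiv i (pderiv 2 f))) * u 2
      = 2 * (eval (p + u) (pderiv i f) - eval p (pderiv i f)))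
      (by simp) (fun f g hf hg => by
        simp only [map_add]; linear_combination hf + hg) ?_ f hf
    intro c a b d habd
    have ha : a ≤ 3 := by omega
    have hb : b ≤ 3 := by omega
    interval_cases a <;> interval_cases b <;> (have hd : d ≤ 3 := by omega) <;>
      interval_cases d <;> (try omega) <;> fin_cases i <;>
      simp [-mul_eq_mul_left_iff, -mul_eq_mul_right_iff, -mul_eq_zero, pderiv_mul, pderiv_pow,
      pderiv_X, Pi.single_apply, pderiv_two, pderiv_three] <;> ring
  rw [h1, h2] at key
  simp only [hess3, Matrix.mulVec, dotProduct, Matrix.add_apply, Matrix.of_apply,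
    Fin.sum_univ_three, Pi.zero_apply]
  linarith

lemma sign_prod (e : Fin 3 → ℝ) (he : ∏ i, e i ≠ 0) :
    0 < (-1 : ℝ) ^ ({i : Fin 3 | e i < 0}.ncard) * ∏ i, e i := by
  classical
  have h1 : {i : Fin 3 | e i < 0}.ncard = (Finset.univ.filter (fun i => e i < 0)).card := by
    rw [← Set.ncard_coe_finset]; simp
  rw [h1, ← Finset.prod_const, Finset.prod_filter, ← Finset.prod_mul_distrib]
  apply Finset.prod_pos
  intro i _
  have : e i ≠ 0 := fun h => he (Finset.prod_eq_zero (Finset.mem_univ i) h)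
  split_ifs with h
  · linarith
  · rcases lt_or_gt_of_ne this with h' | h'
    · exact absurd h' h
    · linarith

lemma morse_sign (f : MvPolynomial (Fin 3) ℝ) (hf : f.totalDegree ≤ 3) (p : Fin 3 → ℝ)
    (h : (hess3 f p).det ≠ 0) :
    0 < (-1 : ℝ) ^ (morseIndex3 f p % 2) * (hess3 f p).det := by
  have hH : (hess3 f p).IsHermitian := by
    rw [Matrix.IsHermitian, Matrix.conjTranspose_eq_transpose_of_trivial]
    exact hess_symm f hf p
  have hd := hH.det_eq_prod_eigenvalues
  simp only [RCLike.ofReal_real_eq_id, id] at hd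
  rw [← neg_one_pow_eq_pow_mod_two, morseIndex3, dif_pos hH, hd]
  exact sign_prod _ (hd ▸ h)

/-- No three distinct nondegenerate critical points on a line. -/
lemma no_collinear (f : MvPolynomial (Fin 3) ℝ) (hf : f.totalDegree ≤ 3) (p u : Fin 3 → ℝ) (k : ℝ)
    (hp : IsCriticalPt3 f p) (hq : IsCriticalPt3 f (p + u)) (hr : IsCriticalPt3 f (p + k • u))
    (hd : (hess3 f p).det ≠ 0) (hu : u ≠ 0) (hk : k ≠ 0) (hk1 : k ≠ 1) : False := by
  have h1 := hess_mid f hf p u hp hq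
  have h2 := hess_mid f hf p (k • u) hp hr
  have h3 := hess_affine f hf p u 0 k 0
  simp only [smul_zero, zero_smul, add_zero] at h3
  rw [h3] at h2
  apply hu
  apply Matrix.eq_zero_of_mulVec_eq_zero hd
  ext i
  have e1 := congrFun h1 i
  have e2 := congrFun h2 i
  simp only [Matrix.mulVec_smul, Matrix.smul_mulVec, Matrix.add_mulVec, Matrix.sub_mulVec,
    Pi.add_apply, Pi.sub_apply, Pi.smul_apply, smul_eq_mul, Pi.zero_apply] at e1 e2 ⊢
  have : k * (1 - k) * (hess3 f p *ᵥ u) i = 0 := by linear_combination (1/2) * (e2 - k ^ 2 * e1)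
  exact (mul_eq_zero.mp this).resolve_left (mul_ne_zero hk (sub_ne_zero.mpr hk1.symm))

/-- **Fundamental lemma.** If `f` is a real polynomial in three variables of total
degree 3 whose complexification has only finitely many critical points in ℂ³, then
there do not exist four pairwise distinct real nondegenerate critical points of `f`
lying in a common affine plane and having Morse indices of the same parity. -/
theorem no_four_coplanar_critical_points_same_parity
    (f : MvPolynomial (Fin 3) ℝ) (hdeg : f.totalDegree = 3)
    (hfin : {p : Fin 3 → ℂ |
        ∀ i, eval p (pderiv i (MvPolynomial.map (algebraMap ℝ ℂ) f)) = 0}.Finite) :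
    ¬ ∃ pts : Fin 4 → (Fin 3 → ℝ), Function.Injective pts ∧
        (∃ W : AffineSubspace ℝ (Fin 3 → ℝ),
          Module.finrank ℝ W.direction = 2 ∧ ∀ k, pts k ∈ W) ∧
        (∀ k, IsCriticalPt3 f (pts k) ∧ (hess3 f (pts k)).det ≠ 0) ∧
        (∀ k l, morseIndex3 f (pts k) % 2 = morseIndex3 f (pts l) % 2) := by
  rintro ⟨pts, hinj, ⟨W, hW, hmem⟩, hcrit, hpar⟩
  have hf : f.totalDegree ≤ 3 := hdeg.le
  obtain ⟨u, hu⟩ : ∃ u, u = pts 1 - pts 0 := ⟨_, rfl⟩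
  obtain ⟨w, hw⟩ : ∃ w, w = pts 2 - pts 0 := ⟨_, rfl⟩
  obtain ⟨v, hv⟩ : ∃ v, v = pts 3 - pts 0 := ⟨_, rfl⟩
  have P1 : pts 1 = pts 0 + u := by rw [hu]; abel
  have P2 : pts 2 = pts 0 + w := by rw [hw]; abel
  have P3 : pts 3 = pts 0 + v := by rw [hv]; abel
  have hu0 : u ≠ 0 := by
    rw [hu, sub_ne_zero]; exact hinj.ne (by decide)
  have hw0 : w ≠ 0 := by
    rw [hw, sub_ne_zero]; exact hinj.ne (by decide)
  have hv0 : v ≠ 0 := by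
    rw [hv, sub_ne_zero]; exact hinj.ne (by decide)
  have c0 := (hcrit 0).1
  have c1 := (hcrit 1).1
  have c2 := (hcrit 2).1
  have c3 := (hcrit 3).1
  have d0 := (hcrit 0).2
  have d1 := (hcrit 1).2
  have hli : LinearIndependent ℝ ![u, w] := by
    rw [LinearIndependent.pair_iff' hu0]
    intro k hk
    refine no_collinear f hf (pts 0) u k c0 (P1 ▸ c1) (by rw [hk, ← P2]; exact c2) d0 hu0 ?_ ?_
    · rintro rfl; apply hw0; rw [← hk, zero_smul]
    · rintro rfl
      rw [one_smul] at hk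
      exact absurd (hinj (P1.trans (hk ▸ P2.symm))) (by decide)
  have hspan : Submodule.span ℝ (Set.range ![u, w]) = W.direction := by
    apply Submodule.eq_of_le_of_finrank_eq
    · rw [Submodule.span_le]
      rintro _ ⟨i, rfl⟩
      fin_cases i
      · simpa [hu] using AffineSubspace.vsub_mem_direction (hmem 1) (hmem 0)
      · simpa [hw] using AffineSubspace.vsub_mem_direction (hmem 2) (hmem 0)
    · rw [hW, finrank_span_eq_card hli]; rfl
  have hvm : v ∈ Submodule.span ℝ (Set.range ![u, w]) := by
    rw [hspan, hv]
    exact AffineSubspace.vsub_mem_direction (hmem 3) (hmem 0)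
  obtain ⟨s, t, hst⟩ : ∃ s t : ℝ, s • u + t • w = v := by
    rw [Matrix.range_cons, Matrix.range_cons, Matrix.range_empty, Set.union_empty,
      Set.singleton_union] at hvm
    exact Submodule.mem_span_pair.mp hvm
  have hs : s ≠ 0 := by
    rintro rfl
    rw [zero_smul, zero_add] at hst
    refine no_collinear f hf (pts 0) w t c0 (P2 ▸ c2) (by rw [hst, ← P3]; exact c3) d0 hw0 ?_ ?_
    · rintro rfl; apply hv0; rw [← hst, zero_smul]
    · rintro rfl
      rw [one_smul] at hst
      exact absurd (hinj (P2.trans (hst ▸ P3.symm))) (by decide)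
  have ht : t ≠ 0 := by
    rintro rfl
    rw [zero_smul, add_zero] at hst
    refine no_collinear f hf (pts 0) u s c0 (P1 ▸ c1) (by rw [hst, ← P3]; exact c3) d0 hu0 ?_ ?_
    · rintro rfl; apply hv0; rw [← hst, zero_smul]
    · rintro rfl
      rw [one_smul] at hst
      exact absurd (hinj (P1.trans (hst ▸ P3.symm))) (by decide)
  have mu := hess_mid f hf (pts 0) u c0 (P1 ▸ c1)
  have mw := hess_mid f hf (pts 0) w c0 (P2 ▸ c2)
  have mv := hess_mid f hf (pts 0) v c0 (P3 ▸ c3)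
  have aff := hess_affine f hf (pts 0) u w s t
  have key := core_gen (hess3 f (pts 0)) (hess3 f (pts 0 + u) - hess3 f (pts 0))
    (hess3 f (pts 0 + w) - hess3 f (pts 0)) s t hs ht (hess_symm f hf _)
    (by rw [Matrix.transpose_sub, hess_symm f hf, hess_symm f hf])
    (by rw [Matrix.transpose_sub, hess_symm f hf, hess_symm f hf]) u w hli
    (hess_third f hf _ _ _)
    (by
      ext i
      have e := congrFun mu i
      simp only [Matrix.smul_mulVec, Matrix.add_mulVec, Matrix.sub_mulVec, Matrix.neg_mulVec,
        Pi.add_apply, Pi.sub_apply, Pi.neg_apply, Pi.smul_apply, smul_eq_mul,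
        Pi.zero_apply] at e ⊢
      linear_combination e)
    (by
      ext i
      have e := congrFun mw i
      simp only [Matrix.smul_mulVec, Matrix.add_mulVec, Matrix.sub_mulVec, Matrix.neg_mulVec,
        Pi.add_apply, Pi.sub_apply, Pi.neg_apply, Pi.smul_apply, smul_eq_mul,
        Pi.zero_apply] at e ⊢
      linear_combination e)
    (by
      rw [← mv, ← hst, aff]
      congr 1
      module)
  rw [← aff, add_sub_cancel, add_sub_cancel, hst, ← P1, ← P2, ← P3] at key
  have s0 := morse_sign f hf _ (hcrit 0).2
  have s1 := morse_sign f hf _ (hcrit 1).2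
  have s2 := morse_sign f hf _ (hcrit 2).2
  have s3 := morse_sign f hf _ (hcrit 3).2
  rw [hpar 0 3] at s0
  rw [hpar 1 3] at s1
  rw [hpar 2 3] at s2
  have q0 := mul_nonneg (sq_nonneg (1 - s - t)) s0.le
  have q1 := mul_nonneg (sq_nonneg s) s1.le
  have q2 := mul_nonneg (sq_nonneg t) s2.le
  have := congrArg (fun y => (-1 : ℝ) ^ (morseIndex3 f (pts 3) % 2) * y) key
  simp only [mul_zero] at this
  linarith
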